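/- Let S : ℝ × [0,T) → ℝ be a smooth function, 2π-periodic in θ, with S_θθ + S > 0, satisfying S_tt = ((S_θt)² − 1)·k where k = 1/(S_θθ + S). Then the area A(t) = (1/2) ∫₀^{2π} S(θ,t) (S_θθ(θ,t) + S(θ,t)) dθ enclosed by the evolving closed curve satisfies A'(t) = ∫₀^{2π} S_t(θ,t) (S_θθ(θ,t) + S(θ,t)) dθ, A''(t) = −2π + ∫₀^{2π} (S_t(θ,t))² dθ, and A'''(t) = 2 ∫₀^{2π} ((S_θt(θ,t))² − 1) k(θ,t) S_t(θ,t) dθ for all t ∈ [0,T). -/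

import Mathlib

open Real Set Function intervalIntegral

/-- Partial derivative in the first (angle) variable. -/
noncomputable def pdθ (S : ℝ → ℝ → ℝ) : ℝ → ℝ → ℝ := fun θ t => deriv (fun y => S y t) θ

/-- Partial derivative in the second (time) variable. -/
noncomputable def pdt (S : ℝ → ℝ → ℝ) : ℝ → ℝ → ℝ := fun θ t => deriv (fun s => S θ s) t

/-- The curvature `k = 1/(S_θθ + S)` of the convex curve with support function `S(·,t)`. -/
noncomputable def curv (S : ℝ → ℝ → ℝ) : ℝ → ℝ → ℝ :=
  fun θ t => 1 / (pdθ (pdθ S) θ t + S θ t)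

/-- The enclosed area `A(t) = (1/2)∫₀^{2π} S (S_θθ + S) dθ` of the evolving closed curve. -/
noncomputable def enclosedArea (S : ℝ → ℝ → ℝ) (t : ℝ) : ℝ :=
  (1 / 2) * ∫ θ in (0:ℝ)..(2 * π), S θ t * (pdθ (pdθ S) θ t + S θ t)

open scoped ContDiff

section PartialDerivatives

variable {F G : ℝ → ℝ → ℝ}

lemma pdθ_eq_fderiv (hF : ContDiff ℝ ∞ (uncurry F)) (θ t : ℝ) :
    pdθ F θ t = fderiv ℝ (uncurry F) (θ, t) (1, 0) := by
  have h := ((hF.differentiable (by simp)) (θ, t)).hasFDerivAt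
  have h2 : HasDerivAt (fun y : ℝ => (y, t)) ((1 : ℝ), (0 : ℝ)) θ :=
    (hasDerivAt_id θ).prodMk (hasDerivAt_const θ t)
  exact (h.comp_hasDerivAt θ h2).deriv

lemma pdt_eq_fderiv (hF : ContDiff ℝ ∞ (uncurry F)) (θ t : ℝ) :
    pdt F θ t = fderiv ℝ (uncurry F) (θ, t) (0, 1) := by
  have h := ((hF.differentiable (by simp)) (θ, t)).hasFDerivAt
  have h2 : HasDerivAt (fun s : ℝ => (θ, s)) ((0 : ℝ), (1 : ℝ)) t :=
    (hasDerivAt_const t θ).prodMk (hasDerivAt_id t)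
  exact (h.comp_hasDerivAt t h2).deriv

lemma contDiff_pdθ (hF : ContDiff ℝ ∞ (uncurry F)) : ContDiff ℝ ∞ (uncurry (pdθ F)) := by
  have : uncurry (pdθ F) = fun p => fderiv ℝ (uncurry F) p (1, 0) := by
    ext ⟨θ, t⟩
    exact pdθ_eq_fderiv hF θ t
  rw [this]
  exact (hF.fderiv_right (m := ∞) (by simp)).clm_apply contDiff_const

lemma contDiff_pdt (hF : ContDiff ℝ ∞ (uncurry F)) : ContDiff ℝ ∞ (uncurry (pdt F)) := by
  have : uncurry (pdt F) = fun p => fderiv ℝ (uncurry F) p (0, 1) := by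
    ext ⟨θ, t⟩
    exact pdt_eq_fderiv hF θ t
  rw [this]
  exact (hF.fderiv_right (m := ∞) (by simp)).clm_apply contDiff_const

lemma hasDerivAt_pdθ (hF : ContDiff ℝ ∞ (uncurry F)) (θ t : ℝ) :
    HasDerivAt (fun y => F y t) (pdθ F θ t) θ := by
  have h : ContDiff ℝ ∞ fun y => F y t := hF.comp (contDiff_id.prodMk contDiff_const)
  exact (h.differentiable (by simp) θ).hasDerivAt

lemma hasDerivAt_pdt (hF : ContDiff ℝ ∞ (uncurry F)) (θ t : ℝ) :
    HasDerivAt (fun s => F θ s) (pdt F θ t) t := by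
  have h : ContDiff ℝ ∞ fun s => F θ s := hF.comp (contDiff_const.prodMk contDiff_id)
  exact (h.differentiable (by simp) t).hasDerivAt

lemma pdt_pdθ_comm (hF : ContDiff ℝ ∞ (uncurry F)) : pdt (pdθ F) = pdθ (pdt F) := by
  have hF' : Differentiable ℝ (fderiv ℝ (uncurry F)) :=
    (hF.fderiv_right (m := ∞) (by simp)).differentiable (by simp)
  have fderiv_apply (p v w : ℝ × ℝ) :
      fderiv ℝ (fun q => fderiv ℝ (uncurry F) q v) p w
        = fderiv ℝ (fderiv ℝ (uncurry F)) p w v := by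
    rw [fderiv_clm_apply (hF' p) (differentiableAt_const v)]
    simp
  have hθ : uncurry (pdθ F) = fun p => fderiv ℝ (uncurry F) p (1, 0) := by
    ext ⟨θ, t⟩
    exact pdθ_eq_fderiv hF θ t
  have ht : uncurry (pdt F) = fun p => fderiv ℝ (uncurry F) p (0, 1) := by
    ext ⟨θ, t⟩
    exact pdt_eq_fderiv hF θ t
  ext θ t
  rw [pdt_eq_fderiv (contDiff_pdθ hF), pdθ_eq_fderiv (contDiff_pdt hF), hθ, ht, fderiv_apply,
    fderiv_apply]
  have h2 : minSmoothness ℝ 2 ≤ ∞ := by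
    simpa using WithTop.coe_le_coe.2 (le_top : (2 : ℕ∞) ≤ ⊤)
  exact hF.contDiffAt.isSymmSndFDerivAt h2 _ _

lemma pdθ_periodic {c : ℝ} (h : ∀ θ t, F (θ + c) t = F θ t) (θ t : ℝ) :
    pdθ F (θ + c) t = pdθ F θ t := by
  unfold pdθ
  rw [← deriv_comp_add_const]
  simp only [h]

lemma pdt_periodic {c : ℝ} (h : ∀ θ t, F (θ + c) t = F θ t) (θ t : ℝ) :
    pdt F (θ + c) t = pdt F θ t := by
  unfold pdt
  simp only [h]

lemma continuous_slice (hF : ContDiff ℝ ∞ (uncurry F)) (t : ℝ) : Continuous fun θ => F θ t :=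
  hF.continuous.comp (continuous_id.prodMk continuous_const)

/-- Integration by parts over one period. -/
lemma integral_mul_pdθ {c : ℝ} (hF : ContDiff ℝ ∞ (uncurry F)) (hG : ContDiff ℝ ∞ (uncurry G))
    (hFc : ∀ θ t, F (θ + c) t = F θ t) (hGc : ∀ θ t, G (θ + c) t = G θ t) (t : ℝ) :
    ∫ θ in (0:ℝ)..c, F θ t * pdθ G θ t = -∫ θ in (0:ℝ)..c, pdθ F θ t * G θ t := by
  rw [integral_mul_deriv_eq_deriv_mul (fun θ _ => hasDerivAt_pdθ hF θ t)
    (fun θ _ => hasDerivAt_pdθ hG θ t)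
    ((continuous_slice (contDiff_pdθ hF) t).intervalIntegrable _ _)
    ((continuous_slice (contDiff_pdθ hG) t).intervalIntegrable _ _)]
  have h1 := hFc 0 t
  have h2 := hGc 0 t
  rw [zero_add] at h1 h2
  rw [h1, h2]
  ring

/-- Differentiation under the integral sign over a compact interval. -/
lemma hasDerivAt_integral_pdt (hF : ContDiff ℝ ∞ (uncurry F)) (a b t : ℝ) :
    HasDerivAt (fun s => ∫ θ in a..b, F θ s) (∫ θ in a..b, pdt F θ t) t := by
  have hF' := contDiff_pdt hF
  obtain ⟨C, hC⟩ := (isCompact_uIcc.prod (isCompact_closedBall t 1)).exists_bound_of_continuousOn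
    (s := uIcc a b ×ˢ Metric.closedBall t 1) hF'.continuous.continuousOn
  refine (hasDerivAt_integral_of_dominated_loc_of_deriv_le (F := fun s θ => F θ s)
    (F' := fun s θ => pdt F θ s) (bound := fun _ => C) (Metric.closedBall_mem_nhds t one_pos)
    (.of_forall fun s => (continuous_slice hF s).aestronglyMeasurable)
    ((continuous_slice hF t).intervalIntegrable _ _)
    (continuous_slice hF' t).aestronglyMeasurable
    (.of_forall fun θ hθ s hs => hC (θ, s) ⟨uIoc_subset_uIcc hθ, hs⟩)
    intervalIntegrable_const
    (.of_forall fun θ _ s _ => hasDerivAt_pdt hF θ s)).2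

lemma contDiff_uncurry_mul (hF : ContDiff ℝ ∞ (uncurry F)) (hG : ContDiff ℝ ∞ (uncurry G)) :
    ContDiff ℝ ∞ (uncurry fun θ t => F θ t * G θ t) :=
  hF.mul hG

lemma contDiff_uncurry_add (hF : ContDiff ℝ ∞ (uncurry F)) (hG : ContDiff ℝ ∞ (uncurry G)) :
    ContDiff ℝ ∞ (uncurry fun θ t => F θ t + G θ t) :=
  hF.add hG

end PartialDerivatives

section Area

variable {S : ℝ → ℝ → ℝ}

lemma hasDerivAt_radius (hS : ContDiff ℝ ∞ (uncurry S)) (θ t : ℝ) :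
    HasDerivAt (fun s => pdθ (pdθ S) θ s + S θ s)
      (pdθ (pdθ (pdt S)) θ t + pdt S θ t) t := by
  rw [← pdt_pdθ_comm hS, ← pdt_pdθ_comm (contDiff_pdθ hS)]
  exact (hasDerivAt_pdt (contDiff_pdθ (contDiff_pdθ hS)) θ t).add (hasDerivAt_pdt hS θ t)

lemma contDiff_radius (hS : ContDiff ℝ ∞ (uncurry S)) :
    ContDiff ℝ ∞ (uncurry fun θ t => pdθ (pdθ S) θ t + S θ t) :=
  contDiff_uncurry_add (contDiff_pdθ (contDiff_pdθ hS)) hS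

lemma hasDerivAt_enclosedArea (hS : ContDiff ℝ ∞ (uncurry S))
    (hper : ∀ θ t, S (θ + 2 * π) t = S θ t) (t : ℝ) :
    HasDerivAt (enclosedArea S)
      (∫ θ in (0:ℝ)..(2 * π), pdt S θ t * (pdθ (pdθ S) θ t + S θ t)) t := by
  have hSt := contDiff_pdt hS
  have hpert := pdt_periodic hper
  have hR := contDiff_radius hS
  have key := (hasDerivAt_integral_pdt (contDiff_uncurry_mul hS hR) 0 (2 * π) t).const_mul (1 / 2)
  refine key.congr_deriv ?_
  have e : ∀ θ, pdt (fun θ t => S θ t * (pdθ (pdθ S) θ t + S θ t)) θ t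
      = pdt S θ t * (pdθ (pdθ S) θ t + S θ t)
        + (S θ t * pdθ (pdθ (pdt S)) θ t + pdt S θ t * S θ t) := fun θ => by
    rw [mul_comm (pdt S θ t) (S θ t), ← mul_add]
    exact ((hasDerivAt_pdt hS θ t).mul (hasDerivAt_radius hS θ t)).deriv
  have c1 := continuous_slice hS t
  have c2 := continuous_slice hSt t
  have c3 := continuous_slice (contDiff_pdθ (contDiff_pdθ hS)) t
  have c4 := continuous_slice (contDiff_pdθ (contDiff_pdθ hSt)) t
  have parts : ∫ θ in (0:ℝ)..(2 * π), S θ t * pdθ (pdθ (pdt S)) θ t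
      = ∫ θ in (0:ℝ)..(2 * π), pdt S θ t * pdθ (pdθ S) θ t := by
    rw [integral_mul_pdθ hS (contDiff_pdθ hSt) hper (pdθ_periodic hpert),
      integral_mul_pdθ hSt (contDiff_pdθ hS) hpert (pdθ_periodic hper)]
    simp only [mul_comm]
  simp only [e]
  rw [integral_add, integral_add, parts, ← integral_add]
  · simp only [← mul_add]
    ring
  all_goals exact Continuous.intervalIntegrable (by fun_prop) _ _

lemma deriv_deriv_enclosedArea (hS : ContDiff ℝ ∞ (uncurry S))
    (hper : ∀ θ t, S (θ + 2 * π) t = S θ t) :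
    deriv (deriv (enclosedArea S)) = fun t => ∫ θ in (0:ℝ)..(2 * π),
      (pdt (pdt S) θ t * (pdθ (pdθ S) θ t + S θ t)
        + pdt S θ t * (pdθ (pdθ (pdt S)) θ t + pdt S θ t)) := by
  have hSt := contDiff_pdt hS
  have hR := contDiff_radius hS
  rw [funext fun t => (hasDerivAt_enclosedArea hS hper t).deriv]
  ext t
  rw [(hasDerivAt_integral_pdt (contDiff_uncurry_mul hSt hR) 0 (2 * π) t).deriv]
  congr 1
  ext θ
  exact ((hasDerivAt_pdt hSt θ t).mul (hasDerivAt_radius hS θ t)).deriv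

lemma differentiable_deriv_deriv_enclosedArea (hS : ContDiff ℝ ∞ (uncurry S))
    (hper : ∀ θ t, S (θ + 2 * π) t = S θ t) :
    Differentiable ℝ (deriv (deriv (enclosedArea S))) := by
  have hSt := contDiff_pdt hS
  rw [deriv_deriv_enclosedArea hS hper]
  exact fun t => (hasDerivAt_integral_pdt (contDiff_uncurry_add
    (contDiff_uncurry_mul (contDiff_pdt hSt) (contDiff_radius hS))
    (contDiff_uncurry_mul hSt (contDiff_radius hSt))) 0 (2 * π) t).differentiableAt

lemma deriv_deriv_enclosedArea_of_flow (hS : ContDiff ℝ ∞ (uncurry S))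
    (hper : ∀ θ t, S (θ + 2 * π) t = S θ t) {t : ℝ}
    (hconv : ∀ θ, 0 < pdθ (pdθ S) θ t + S θ t)
    (hpde : ∀ θ, pdt (pdt S) θ t = ((pdθ (pdt S) θ t) ^ 2 - 1) * curv S θ t) :
    deriv (deriv (enclosedArea S)) t
      = -(2 * π) + ∫ θ in (0:ℝ)..(2 * π), (pdt S θ t) ^ 2 := by
  have hSt := contDiff_pdt hS
  have hpert := pdt_periodic hper
  have e : ∀ θ, pdt (pdt S) θ t * (pdθ (pdθ S) θ t + S θ t)
        + pdt S θ t * (pdθ (pdθ (pdt S)) θ t + pdt S θ t)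
      = (pdθ (pdt S) θ t * pdθ (pdt S) θ t + pdt S θ t * pdθ (pdθ (pdt S)) θ t)
        + (-1 + (pdt S θ t) ^ 2) := fun θ => by
    have h := (hconv θ).ne'
    rw [hpde, curv, mul_assoc, one_div_mul_cancel h]
    ring
  have c2 := continuous_slice hSt t
  have c3 := continuous_slice (contDiff_pdθ hSt) t
  have c4 := continuous_slice (contDiff_pdθ (contDiff_pdθ hSt)) t
  rw [deriv_deriv_enclosedArea hS hper]
  simp only [e]
  rw [integral_add, integral_add, integral_add,
    integral_mul_pdθ hSt (contDiff_pdθ hSt) hpert (pdθ_periodic hpert)]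
  · simp
  all_goals exact Continuous.intervalIntegrable (by fun_prop) _ _

end Area

/-- Along the hyperbolic mean curvature flow `S_tt = ((S_θt)² − 1)·k`, the area `A(t)`
enclosed by the evolving closed curve satisfies
`A'(t) = ∫₀^{2π} S_t (S_θθ + S) dθ`, `A''(t) = −2π + ∫₀^{2π} S_t² dθ`, and
`A'''(t) = 2∫₀^{2π} ((S_θt)² − 1) k S_t dθ`. -/
theorem area_evolution
    (T : ℝ) (S : ℝ → ℝ → ℝ)
    (hS : ContDiff ℝ (⊤ : ℕ∞) (uncurry S))
    (hper : ∀ θ t, S (θ + 2 * π) t = S θ t)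
    (hconv : ∀ θ t, t ∈ Ico (0:ℝ) T → 0 < pdθ (pdθ S) θ t + S θ t)
    (hpde : ∀ θ t, t ∈ Ico (0:ℝ) T →
      pdt (pdt S) θ t = ((pdθ (pdt S) θ t) ^ 2 - 1) * curv S θ t) :
    ∀ t ∈ Ico (0:ℝ) T,
      deriv (enclosedArea S) t =
        (∫ θ in (0:ℝ)..(2 * π), pdt S θ t * (pdθ (pdθ S) θ t + S θ t)) ∧
      deriv (deriv (enclosedArea S)) t =
        -(2 * π) + ∫ θ in (0:ℝ)..(2 * π), (pdt S θ t) ^ 2 ∧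
      deriv (deriv (deriv (enclosedArea S))) t =
        2 * ∫ θ in (0:ℝ)..(2 * π), ((pdθ (pdt S) θ t) ^ 2 - 1) * curv S θ t * pdt S θ t := by
  intro t ht
  have hS2 {s : ℝ} (hs : s ∈ Ico (0:ℝ) T) :=
    deriv_deriv_enclosedArea_of_flow hS hper (fun θ => hconv θ s hs) (fun θ => hpde θ s hs)
  refine ⟨(hasDerivAt_enclosedArea hS hper t).deriv, hS2 ht, ?_⟩
  have hSt := contDiff_pdt hS
  have hsq : HasDerivAt (fun s => -(2 * π) + ∫ θ in (0:ℝ)..(2 * π), (pdt S θ s) ^ 2)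
      (∫ θ in (0:ℝ)..(2 * π), pdt (fun θ s => (pdt S θ s) ^ 2) θ t) t :=
    (hasDerivAt_integral_pdt (F := fun θ s => (pdt S θ s) ^ 2) (hSt.pow 2) 0 (2 * π) t).const_add _
  have hA := (differentiable_deriv_deriv_enclosedArea hS hper t).hasDerivAt
  have huniq := (uniqueDiffOn_Ico (0:ℝ) T).uniqueDiffWithinAt ht
  rw [huniq.eq_deriv _ hA.hasDerivWithinAt
    (hsq.hasDerivWithinAt.congr (fun s hs => hS2 hs) (hS2 ht)), ← integral_const_mul]
  congr 1
  ext θ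
  rw [← hpde θ t ht]
  refine ((hasDerivAt_pdt hSt θ t).pow 2).deriv.trans ?_
  ring
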